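/- Let 1 ≤ m ≤ k and let λ, μ ∈ L^k(m,n), i.e., λ ≼ (m^n) and μ ≼ (m^n) in the k-Young order. Then μ ≼ λ in the k-Young order if and only if μ ⊆ λ. Hence L^k(m,n) is isomorphic to the induced subposet of the Young lattice interval L(m,n) on the vertex set of L^k(m,n). -/

import Mathlib

/-- A partition: a weakly decreasing list of positive integers. -/
def IsPartition (l : List ℕ) : Prop :=
  l.Pairwise (· ≥ ·) ∧ ∀ x ∈ l, 0 < x

/-- The `i`-th part (0-indexed), with parts beyond the length equal to 0. -/
def part (l : List ℕ) (i : ℕ) : ℕ := l.getD i 0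

/-- Diagram containment `l ⊆ m`: every part of `l` is at most the corresponding part of `m`. -/
def SubDiag (l m : List ℕ) : Prop := ∀ i, part l i ≤ part m i

/-- A `k`-bounded partition: a partition whose first part is at most `k`. -/
def KBounded (k : ℕ) (l : List ℕ) : Prop := IsPartition l ∧ part l 0 ≤ k

/-- Hook length of the square `(i,j)` (0-indexed) with respect to the skew diagram
`outer/inner`: the number of cells `(i,j')` of the skew diagram with `j' ≥ j` plus the
number of cells `(i',j)` of the skew diagram with `i' > i`. -/
def hookLen (outer inner : List ℕ) (i j : ℕ) : ℕ :=
  ((Finset.range (part outer i)).filter (fun j' => j ≤ j' ∧ part inner i ≤ j')).card +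
  ((Finset.range outer.length).filter
    (fun i' => i < i' ∧ part inner i' ≤ j ∧ j < part outer i')).card

/-- `(outer, inner)` is the `k`-skew diagram of the `k`-bounded partition `l`:
row `i` of `outer/inner` has `l i` cells, every cell of `outer/inner` has hook length
at most `k`, and every square of the inner shape has hook length exceeding `k`. -/
def IsKSkew (k : ℕ) (l outer inner : List ℕ) : Prop :=
  IsPartition outer ∧ IsPartition inner ∧ SubDiag inner outer ∧
  (∀ i, part outer i - part inner i = part l i) ∧
  (∀ i j, part inner i ≤ j → j < part outer i → hookLen outer inner i j ≤ k) ∧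
  (∀ i j, j < part inner i → k < hookLen outer inner i j)

/-- Length of column `j` of the skew diagram `outer/inner`. -/
def colLen (outer inner : List ℕ) (j : ℕ) : ℕ :=
  ((Finset.range outer.length).filter
    (fun i => part inner i ≤ j ∧ j < part outer i)).card

/-- The list of column lengths of the skew diagram `outer/inner`. -/
def skewCols (outer inner : List ℕ) : List ℕ :=
  ((List.range (part outer 0)).map (colLen outer inner)).filter (fun x => decide (x ≠ 0))

/-- The `k`-conjugate of `l`: the partition whose parts are the column lengths of the
(unique) `k`-skew diagram of `l`. -/
noncomputable def kConj (k : ℕ) (l : List ℕ) : List ℕ :=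
  haveI := Classical.dec (∃ p : List ℕ × List ℕ, IsKSkew k l p.1 p.2)
  if h : ∃ p : List ℕ × List ℕ, IsKSkew k l p.1 p.2 then
    skewCols h.choose.1 h.choose.2
  else []

/-- The covering relation of the `k`-Young order on `k`-bounded partitions. -/
def KCover (k : ℕ) (l m : List ℕ) : Prop :=
  KBounded k l ∧ KBounded k m ∧ SubDiag l m ∧
  SubDiag (kConj k l) (kConj k m) ∧ m.sum = l.sum + 1

/-- The `k`-Young order: reflexive-transitive closure of the covering relation. -/
def KLe (k : ℕ) : List ℕ → List ℕ → Prop := Relation.ReflTransGen (KCover k)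

/-- The weakly decreasing rearrangement of the combined parts of two partitions. -/
def punion (l r : List ℕ) : List ℕ := (l ++ r).mergeSort (fun a b => decide (a ≥ b))

/-- The ordinary conjugate of a partition: the list of column lengths of its diagram. -/
def conj (l : List ℕ) : List ℕ :=
  (List.range (part l 0)).map (fun j => (l.filter (fun x => decide (j < x))).length)

theorem part_zero_cons (x : ℕ) (l : List ℕ) : part (x :: l) 0 = x := rfl

theorem part_succ_cons (x : ℕ) (l : List ℕ) (i : ℕ) : part (x :: l) (i + 1) = part l i := rfl

theorem part_nil (i : ℕ) : part [] i = 0 := by simp [part]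

theorem part_tail (l : List ℕ) (i : ℕ) : part l.tail i = part l (i + 1) := by
  cases l <;> simp [part]

theorem isPartition_nil : IsPartition [] := by simp [IsPartition]

theorem isPartition_cons {x : ℕ} {l : List ℕ} :
    IsPartition (x :: l) ↔ 0 < x ∧ part l 0 ≤ x ∧ IsPartition l := by
  cases l with
  | nil => simp [IsPartition, part]
  | cons y l =>
    simp only [IsPartition, List.pairwise_cons, List.mem_cons, part_zero_cons,
      forall_eq_or_imp]
    constructor
    · rintro ⟨⟨⟨h1, h2⟩, h3, h4⟩, h5, h6, h7⟩
      exact ⟨h5, h1, ⟨h3, h4⟩, h6, h7⟩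
    · rintro ⟨h5, h1, ⟨h3, h4⟩, h6, h7⟩
      exact ⟨⟨⟨h1, fun a ha => (h3 a ha).trans h1⟩, h3, h4⟩, h5, h6, h7⟩

theorem IsPartition.tail {l : List ℕ} (h : IsPartition l) : IsPartition l.tail := by
  cases l with
  | nil => exact h
  | cons x l => exact (isPartition_cons.1 h).2.2

theorem IsPartition.part_le_part_zero {l : List ℕ} (h : IsPartition l) (i : ℕ) :
    part l i ≤ part l 0 := by
  induction l generalizing i with
  | nil => simp [part_nil]
  | cons x l ih =>
    obtain ⟨_, h1, h2⟩ := isPartition_cons.1 h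
    cases i with
    | zero => rfl
    | succ i => exact (ih h2 i).trans h1

theorem IsPartition.le_part_zero {l : List ℕ} (h : IsPartition l) {x : ℕ} (hx : x ∈ l) :
    x ≤ part l 0 := by
  cases l with
  | nil => simp at hx
  | cons y l =>
    rcases List.mem_cons.1 hx with rfl | hx
    · rfl
    · exact (List.pairwise_cons.1 h.1).1 x hx

theorem SubDiag.refl (l : List ℕ) : SubDiag l l := fun _ => le_rfl

theorem SubDiag.trans {l₁ l₂ l₃ : List ℕ} (h : SubDiag l₁ l₂) (h' : SubDiag l₂ l₃) :
    SubDiag l₁ l₃ := fun i => (h i).trans (h' i)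

theorem subDiag_cons {x y : ℕ} {l l' : List ℕ} :
    SubDiag (x :: l) (y :: l') ↔ x ≤ y ∧ SubDiag l l' := by
  constructor
  · intro h
    exact ⟨h 0, fun i => h (i + 1)⟩
  · rintro ⟨h0, h1⟩ (_ | i)
    · exact h0
    · exact h1 i

theorem subDiag_nil (l : List ℕ) : SubDiag [] l := fun i => by simp [part_nil]

theorem SubDiag.eq_nil {l : List ℕ} (hl : IsPartition l) (h : SubDiag l []) : l = [] := by
  cases l with
  | nil => rfl
  | cons x l =>
    have h0 := h 0
    have := (isPartition_cons.1 hl).1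
    simp only [part_zero_cons, part_nil] at h0
    omega

theorem SubDiag.sum_le {l l' : List ℕ} (hl : IsPartition l) (h : SubDiag l l') :
    l.sum ≤ l'.sum := by
  induction l' generalizing l with
  | nil => simp [h.eq_nil hl]
  | cons y l' ih =>
    cases l with
    | nil => simp
    | cons x l =>
      rw [subDiag_cons] at h
      have := ih (isPartition_cons.1 hl).2.2 h.2
      simp only [List.sum_cons]
      omega

theorem SubDiag.countP_lt_le {l l' : List ℕ} (hl : IsPartition l) (h : SubDiag l l') (r : ℕ) :
    l.countP (fun x => decide (r < x)) ≤ l'.countP (fun x => decide (r < x)) := by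
  induction l' generalizing l with
  | nil => simp [h.eq_nil hl]
  | cons y l' ih =>
    cases l with
    | nil => simp
    | cons x l =>
      rw [subDiag_cons] at h
      have := ih (isPartition_cons.1 hl).2.2 h.2
      simp only [List.countP_cons, decide_eq_true_eq]
      split_ifs <;> omega

theorem card_filter_range_succ (p : ℕ → Prop) [DecidablePred p] (n : ℕ) :
    ((Finset.range (n + 1)).filter p).card =
      (if p 0 then 1 else 0) + ((Finset.range n).filter (fun i => p (i + 1))).card := by
  simp only [Finset.card_filter, Finset.sum_range_succ']
  omega

theorem colLen_cons (o : ℕ) (O I : List ℕ) (j : ℕ) :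
    colLen (o :: O) I j = (if part I 0 ≤ j ∧ j < o then 1 else 0) + colLen O I.tail j := by
  simp only [colLen, List.length_cons, card_filter_range_succ, part_zero_cons, part_succ_cons,
    part_tail]
  congr!

theorem card_row (a b j : ℕ) :
    ((Finset.range a).filter (fun j' => j ≤ j' ∧ b ≤ j')).card = a - max j b := by
  rw [← Nat.card_Ico]
  congr 1
  ext x
  simp only [Finset.mem_filter, Finset.mem_range, Finset.mem_Ico, max_le_iff]
  tauto

theorem hookLen_cons_zero (o : ℕ) (O I : List ℕ) (j : ℕ) :
    hookLen (o :: O) I 0 j = (o - max j (part I 0)) + colLen O I.tail j := by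
  simp only [hookLen, colLen, card_row, List.length_cons, card_filter_range_succ, part_zero_cons,
    part_succ_cons, part_tail]
  simp

theorem hookLen_cons_succ (o : ℕ) (O I : List ℕ) (i j : ℕ) :
    hookLen (o :: O) I (i + 1) j = hookLen O I.tail i j := by
  simp only [hookLen, List.length_cons, card_filter_range_succ, part_succ_cons, part_tail]
  simp

theorem colLen_eq_zero {O I : List ℕ} (hO : IsPartition O) {j : ℕ} (hj : part O 0 ≤ j) :
    colLen O I j = 0 := by
  simp only [colLen, Finset.card_eq_zero, Finset.filter_eq_empty_iff]
  intro i _ h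
  have := hO.part_le_part_zero i
  omega

theorem colLen_antitoneOn {O I : List ℕ} (hI : IsPartition I) {j j' : ℕ} (hj : part I 0 ≤ j)
    (hjj' : j ≤ j') : colLen O I j' ≤ colLen O I j := by
  apply Finset.card_le_card
  intro i hi
  simp only [Finset.mem_filter] at hi ⊢
  have := hI.part_le_part_zero i
  exact ⟨hi.1, by omega, by omega⟩

theorem IsKSkew.of_cons {k x : ℕ} {l O I : List ℕ} (hx : 0 < x) (h : IsKSkew k (x :: l) O I) :
    ∃ O', O = (part I 0 + x) :: O' ∧ IsKSkew k l O' I.tail ∧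
      (∀ j, j < part I 0 → k < x + colLen O' I.tail j) ∧
      (∀ j, part I 0 ≤ j → j < part I 0 + x →
        part I 0 + x - j + colLen O' I.tail j ≤ k) := by
  obtain ⟨hO, hI, hs, hr, hc, hi⟩ := h
  cases O with
  | nil =>
    have := hr 0
    simp only [part_nil, part_zero_cons] at this
    omega
  | cons o O' =>
    have h0 := hr 0
    simp only [part_zero_cons] at h0
    obtain rfl : o = part I 0 + x := by omega
    refine ⟨O', rfl, ⟨(isPartition_cons.1 hO).2.2, hI.tail, fun i => ?_, fun i => ?_,
      fun i j h1 h2 => ?_, fun i j h1 => ?_⟩, fun j hj => ?_, fun j h1 h2 => ?_⟩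
    · rw [part_tail]
      exact hs (i + 1)
    · rw [part_tail]
      exact hr (i + 1)
    · have := hc (i + 1) j (by rwa [part_tail] at h1) h2
      rwa [hookLen_cons_succ] at this
    · have := hi (i + 1) j (by rwa [part_tail] at h1)
      rwa [hookLen_cons_succ] at this
    · have := hi 0 j hj
      rw [hookLen_cons_zero, max_eq_right hj.le] at this
      omega
    · have := hc 0 j h1 h2
      rwa [hookLen_cons_zero, max_eq_left h1] at this

theorem IsKSkew.cons {k x : ℕ} {l O I I' : List ℕ} (hx : 0 < x) (h : IsKSkew k l O I)
    (hI' : IsPartition I') (htail : I'.tail = I) (hO : part O 0 ≤ part I' 0 + x)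
    (hin : ∀ j, j < part I' 0 → k < x + colLen O I j)
    (hcell : ∀ j, part I' 0 ≤ j → j < part I' 0 + x → part I' 0 + x - j + colLen O I j ≤ k) :
    IsKSkew k (x :: l) ((part I' 0 + x) :: O) I' := by
  subst htail
  obtain ⟨hO', hI, hs, hr, hc, hi⟩ := h
  simp only [SubDiag, part_tail] at hs hr hc hi
  refine ⟨isPartition_cons.2 ⟨by omega, hO, hO'⟩, hI', ?_, ?_, ?_, ?_⟩
  · rintro (_ | i)
    · simp [part_zero_cons]
    · exact hs i
  · rintro (_ | i)
    · simp [part_zero_cons]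
    · exact hr i
  · rintro (_ | i) j h1 h2
    · rw [hookLen_cons_zero, max_eq_left h1]
      exact hcell j h1 h2
    · rw [hookLen_cons_succ]
      exact hc i j h1 h2
  · rintro (_ | i) j h1
    · rw [hookLen_cons_zero, max_eq_right h1.le]
      have := hin j h1
      omega
    · rw [hookLen_cons_succ]
      exact hi i j h1

theorem isKSkew_nil (k : ℕ) : IsKSkew k [] [] [] := by
  refine ⟨isPartition_nil, isPartition_nil, .refl _, ?_, ?_, ?_⟩ <;> simp [part_nil]

theorem exists_isPartition_cons_zero {I : List ℕ} (hI : IsPartition I) {s : ℕ}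
    (hs : part I 0 ≤ s) : ∃ I', IsPartition I' ∧ I'.tail = I ∧ part I' 0 = s := by
  rcases Nat.eq_zero_or_pos s with rfl | h
  · have : I = [] := by
      cases I with
      | nil => rfl
      | cons x I =>
        have := (isPartition_cons.1 hI).1
        simp only [part_zero_cons] at hs
        omega
    exact ⟨[], isPartition_nil, this.symm, part_nil 0⟩
  · exact ⟨s :: I, isPartition_cons.2 ⟨h, hs, hI⟩, rfl, rfl⟩

theorem IsKSkew.lt_add_colLen {k : ℕ} {l O I : List ℕ} (h : IsKSkew k l O I) {j : ℕ}
    (hj : j < part I 0) : k < part l 0 + colLen O I j := by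
  obtain ⟨-, -, hs, hr, -, hi⟩ := h
  have h0 := hi 0 j hj
  have h1 := hs 0
  have h2 := hr 0
  cases O with
  | nil =>
    simp only [part_nil] at h1
    omega
  | cons o O =>
    rw [hookLen_cons_zero, max_eq_right hj.le] at h0
    rw [colLen_cons]
    simp only [part_zero_cons] at h2
    omega

theorem exists_isKSkew {k : ℕ} {l : List ℕ} (hl : KBounded k l) :
    ∃ O I, IsKSkew k l O I := by
  induction l with
  | nil => exact ⟨[], [], isKSkew_nil k⟩
  | cons x l ih =>
    obtain ⟨hp, hk⟩ := hl
    obtain ⟨hx, hxl, hp'⟩ := isPartition_cons.1 hp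
    rw [part_zero_cons] at hk
    obtain ⟨O, I, h⟩ := ih ⟨hp', hxl.trans hk⟩
    have hex : ∃ s, x + colLen O I s ≤ k := ⟨part O 0, by rw [colLen_eq_zero h.1 le_rfl]; omega⟩
    classical
    have hspec := Nat.find_spec hex
    have hmin : ∀ j, j < Nat.find hex → k < x + colLen O I j :=
      fun j hj => not_le.1 (Nat.find_min hex hj)
    generalize Nat.find hex = s at hspec hmin
    have hs : part I 0 ≤ s := by
      by_contra! hlt
      have := h.lt_add_colLen hlt
      omega
    obtain ⟨I', hI', htail, hs'⟩ := exists_isPartition_cons_zero h.2.1 hs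
    have hr := h.2.2.2.1 0
    refine ⟨_, I', h.cons hx hI' htail (by omega) (by rwa [hs']) ?_⟩
    intro j h1 h2
    have := colLen_antitoneOn (O := O) h.2.1 hs (hs' ▸ h1)
    omega

theorem exists_kConj_eq {k : ℕ} {l : List ℕ} (hl : KBounded k l) :
    ∃ O I, IsKSkew k l O I ∧ kConj k l = skewCols O I := by
  obtain ⟨O, I, h⟩ := exists_isKSkew hl
  have hex : ∃ p : List ℕ × List ℕ, IsKSkew k l p.1 p.2 := ⟨(O, I), h⟩
  exact ⟨_, _, hex.choose_spec, by rw [kConj, dif_pos hex]⟩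

theorem part_filter_map_range {f : ℕ → ℕ} (hf : Antitone f) (N : ℕ) (hN : ∀ j, N ≤ j → f j = 0)
    (j : ℕ) : part (((List.range N).map f).filter (fun x => decide (x ≠ 0))) j = f j := by
  induction N generalizing f j with
  | zero => simp [part, hN j]
  | succ N ih =>
    by_cases h0 : f 0 = 0
    · have hz : ∀ i, f i = 0 := fun i => by
        have := hf (Nat.zero_le i)
        omega
      have hnil : ((List.range (N + 1)).map f).filter (fun x => decide (x ≠ 0)) = [] := by
        simp [List.filter_eq_nil_iff, hz]
      rw [hnil, part_nil, hz]
    · rw [List.range_succ_eq_map, List.map_cons, List.filter_cons_of_pos (by simpa using h0)]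
      cases j with
      | zero => rfl
      | succ j =>
        rw [part_succ_cons, List.map_map]
        exact ih (f := f ∘ Nat.succ) (fun a b hab => hf (Nat.succ_le_succ hab))
          (fun i hi => hN _ (Nat.succ_le_succ hi)) j

theorem part_zero_skewCols {O I : List ℕ} (hO : IsPartition O) (h : 0 < colLen O I 0) :
    part (skewCols O I) 0 = colLen O I 0 := by
  have h0 : 0 < part O 0 := by
    by_contra! h'
    rw [colLen_eq_zero hO h'] at h
    omega
  obtain ⟨N, hN⟩ := Nat.exists_eq_succ_of_ne_zero h0.ne'
  rw [skewCols, hN, List.range_succ_eq_map, List.map_cons,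
    List.filter_cons_of_pos (by simpa using h.ne')]
  rfl

/-- A partition with parts at most `m` of which at most `c` are smaller than `m`. -/
def FewSmallParts (m c : ℕ) (l : List ℕ) : Prop :=
  IsPartition l ∧ part l 0 ≤ m ∧ l.countP (fun x => decide (x < m)) ≤ c

/-- The columns of `l`, cut into pieces of height `c` that are listed periodically with
period `m`. -/
def cutCol (m c : ℕ) (l : List ℕ) (j : ℕ) : ℕ :=
  min c (l.countP (fun x => decide (j % m < x)) - j / m * c)

theorem countP_lt_add_countP_lt_le {l : List ℕ} (m r : ℕ) (hr : r < m) :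
    l.countP (fun x => decide (r < x)) ≤
      l.countP (fun x => decide (m - 1 < x)) + l.countP (fun x => decide (x < m)) := by
  induction l with
  | nil => simp
  | cons x l ih =>
    simp only [List.countP_cons, decide_eq_true_eq]
    split_ifs <;> omega

theorem countP_lt_antitone (l : List ℕ) :
    Antitone fun r => l.countP (fun x => decide (r < x)) := by
  intro r r' h
  apply List.countP_mono_left
  intro x _ hx
  simp only [decide_eq_true_eq] at hx ⊢
  omega

theorem cutCol_antitone {m c : ℕ} (hm : 1 ≤ m) {l : List ℕ}
    (hl : l.countP (fun x => decide (x < m)) ≤ c) : Antitone (cutCol m c l) := by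
  refine antitone_nat_of_succ_le fun j => ?_
  simp only [cutCol]
  have hdiv := Nat.div_add_mod j m
  have hlt := Nat.mod_lt j (by omega : m > 0)
  by_cases h : j % m + 1 < m
  · have h1 : (j + 1) % m = j % m + 1 := by
      rw [← Nat.mod_eq_of_lt h, Nat.mod_add_mod]
    have h2 : (j + 1) / m = j / m := by
      rw [Nat.div_eq_iff (by omega)]
      constructor <;> rw [mul_comm] <;> omega
    rw [h1, h2]
    have := countP_lt_antitone l (Nat.le_succ (j % m))
    simp only [Nat.succ_eq_add_one] at this
    omega
  · have h1 : j + 1 = m * (j / m + 1) := by rw [mul_add]; omega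
    have h2 : (j + 1) % m = 0 := by rw [h1, Nat.mul_mod_right]
    have h3 : (j + 1) / m = j / m + 1 := by rw [h1, Nat.mul_div_cancel_left _ (by omega)]
    have h4 : j % m = m - 1 := by omega
    have := countP_lt_add_countP_lt_le (l := l) m 0 (by omega)
    rw [h2, h3, h4, add_mul]
    omega

theorem FewSmallParts.of_cons {m c x : ℕ} {l : List ℕ} (h : FewSmallParts m c (x :: l)) :
    FewSmallParts m c l := by
  obtain ⟨hp, h0, hc⟩ := h
  obtain ⟨_, hxl, hp'⟩ := isPartition_cons.1 hp
  refine ⟨hp', hxl.trans h0, ?_⟩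
  rw [List.countP_cons] at hc
  omega

theorem FewSmallParts.length_le {m c x : ℕ} {l : List ℕ} (h : FewSmallParts m c (x :: l))
    (hx : x < m) : l.length + 1 ≤ c := by
  have hall : (x :: l).countP (fun y => decide (y < m)) = (x :: l).length := by
    rw [List.countP_eq_length]
    intro y hy
    have := h.1.le_part_zero hy
    rw [part_zero_cons] at this
    simp only [decide_eq_true_eq]
    omega
  have := h.2.2
  rw [hall] at this
  exact this

/-- Column lengths of the `k`-skew diagram of a partition with parts at most `m`, of which at most
`c = k - m + 1` are smaller than `m`. -/
theorem IsKSkew.colLen_eq_cutCol {k m c : ℕ} (hm : 1 ≤ m) (hc : m + c = k + 1) (hc1 : 1 ≤ c)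
    {l O I : List ℕ} (hl : FewSmallParts m c l) (h : IsKSkew k l O I) (j : ℕ) :
    colLen O I j = cutCol m c l j := by
  induction l generalizing O I j with
  | nil =>
    simp only [cutCol, List.countP_nil, Nat.zero_sub, Nat.min_zero, colLen, Finset.card_eq_zero,
      Finset.filter_eq_empty_iff]
    intro i _ hi
    have := h.2.2.2.1 i
    rw [part_nil] at this
    omega
  | cons x l ih =>
    have hx := (isPartition_cons.1 hl.1).1
    obtain ⟨O', rfl, h', hin, hcell⟩ := h.of_cons hx
    have ih := fun j => ih hl.of_cons h' j
    have hanti := cutCol_antitone hm hl.of_cons.2.2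
    have hr : j % m < m := Nat.mod_lt _ hm
    have hjm := Nat.div_add_mod j m
    simp only [ih] at hin hcell
    rw [colLen_cons, ih]
    generalize part I 0 = s at hin hcell
    have hxm : x ≤ m := hl.2.1
    rcases hxm.lt_or_eq with hxm | rfl
    · have hlen := hl.length_le hxm
      have hcount : ∀ r, l.countP (fun y => decide (r < y)) ≤ l.length :=
        fun r => List.countP_le_length
      obtain rfl : s = 0 := by
        by_contra hs
        have := hin 0 (by omega)
        have h0 := hcount (0 % m)
        simp only [cutCol] at this
        omega
      simp only [cutCol, List.countP_cons, decide_eq_true_eq]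
      have h0 := hcount (j % m)
      rcases Nat.eq_zero_or_pos (j / m) with hq | hq
      · rw [hq] at hjm ⊢
        have : j % m = j := by omega
        rw [this] at h0 ⊢
        split_ifs <;> omega
      · have h1 : c ≤ j / m * c := Nat.le_mul_of_pos_left c hq
        have h2 : m ≤ m * (j / m) := Nat.le_mul_of_pos_right m hq
        split_ifs <;> omega
    · have hs : cutCol x c l s < c := by
        have := hcell s le_rfl (by omega)
        omega
      have hge : ∀ i, s ≤ i → cutCol x c l i < c := fun i hi => (hanti hi).trans_lt hs
      have hlt : ∀ i, i < s → cutCol x c l i = c := by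
        intro i hi
        have h1 := hin i hi
        have h2 : cutCol x c l i ≤ c := min_le_left _ _
        omega
      have hsub : x ≤ j → (j - x) % x = j % x ∧ (j - x) / x * c + c = j / x * c := by
        intro hxj
        obtain ⟨t, rfl⟩ := Nat.exists_eq_add_of_le hxj
        refine ⟨by simp, ?_⟩
        rw [Nat.add_sub_cancel_left, Nat.add_div_left _ hx]
        simp [add_mul]
      have hsmall : j < x → j / x * c = 0 := fun hj => by simp [Nat.div_eq_of_lt hj]
      have hge1 := hge j
      have hlt1 := hlt j
      have hge2 := hge (j - x)
      have hlt2 := hlt (j - x)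
      simp only [cutCol, List.countP_cons, decide_eq_true_eq, if_pos hr] at hge1 hlt1 hge2 hlt2 ⊢
      rcases Nat.lt_or_ge j x with hjx | hjx
      · have := hsmall hjx
        split_ifs <;> omega
      · obtain ⟨h1, h2⟩ := hsub hjx
        rw [h1] at hge2 hlt2
        split_ifs <;> omega

theorem FewSmallParts.part_kConj {k m c : ℕ} (hm : 1 ≤ m) (hc : m + c = k + 1) (hc1 : 1 ≤ c)
    {l : List ℕ} (hl : FewSmallParts m c l) (j : ℕ) : part (kConj k l) j = cutCol m c l j := by
  obtain ⟨O, I, h, heq⟩ := exists_kConj_eq (k := k) ⟨hl.1, hl.2.1.trans (by omega)⟩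
  have hcol : colLen O I = cutCol m c l := funext (h.colLen_eq_cutCol hm hc hc1 hl)
  rw [heq, skewCols, part_filter_map_range (hcol ▸ cutCol_antitone hm hl.2.2) _
    (fun i hi => colLen_eq_zero h.1 hi), hcol]

theorem IsKSkew.min_countP_le_colLen {k m c : ℕ} (hc : m + c = k + 1) {l O I : List ℕ}
    (hl : IsPartition l) (h : IsKSkew k l O I) :
    min (l.countP (fun x => decide (x < m))) (c + 1) ≤ colLen O I 0 := by
  induction l generalizing O I with
  | nil => simp
  | cons x l ih =>
    obtain ⟨hx, -, hl'⟩ := isPartition_cons.1 hl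
    obtain ⟨O', rfl, h', hin, -⟩ := h.of_cons hx
    have ih := ih hl' h'
    have hin0 := hin 0
    simp only [colLen_cons, List.countP_cons, decide_eq_true_eq]
    split_ifs <;> omega

theorem fewSmallParts_of_part_kConj_le {k m c : ℕ} (hc : m + c = k + 1) (hc1 : 1 ≤ c)
    {l : List ℕ} (hl : IsPartition l) (hlm : part l 0 ≤ m) (h : part (kConj k l) 0 ≤ c) :
    FewSmallParts m c l := by
  refine ⟨hl, hlm, ?_⟩
  obtain ⟨O, I, hs, heq⟩ := exists_kConj_eq (k := k) ⟨hl, hlm.trans (by omega)⟩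
  have := hs.min_countP_le_colLen hc hl
  by_contra! hlt
  rw [heq, part_zero_skewCols hs.1 (by omega)] at h
  omega

theorem fewSmallParts_replicate {m c : ℕ} (hm : 1 ≤ m) (n : ℕ) :
    FewSmallParts m c (List.replicate n m) := by
  refine ⟨⟨?_, ?_⟩, ?_, ?_⟩
  · simp [List.pairwise_replicate]
  · intro x hx
    rw [List.eq_of_mem_replicate hx]
    omega
  · cases n <;> simp [part, List.replicate_succ]
  · simp [List.countP_replicate]

theorem KLe.subDiag {k : ℕ} {l l' : List ℕ} (h : KLe k l l') : SubDiag l l' := by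
  induction h with
  | refl => exact .refl _
  | tail _ h ih => exact ih.trans h.2.2.1

theorem KLe.subDiag_kConj {k : ℕ} {l l' : List ℕ} (h : KLe k l l') :
    SubDiag (kConj k l) (kConj k l') := by
  induction h with
  | refl => exact .refl _
  | tail _ h ih => exact ih.trans h.2.2.2.1

theorem KLe.isPartition {k : ℕ} {l l' : List ℕ} (h : KLe k l l') (hl' : IsPartition l') :
    IsPartition l := by
  rcases Relation.ReflTransGen.cases_head h with rfl | ⟨_, hc, _⟩
  · exact hl'
  · exact hc.1.1

theorem KLe.fewSmallParts {k m c n : ℕ} (hm : 1 ≤ m) (hc : m + c = k + 1) (hc1 : 1 ≤ c)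
    {l : List ℕ} (h : KLe k l (List.replicate n m)) : FewSmallParts m c l := by
  have hrep := fewSmallParts_replicate (c := c) hm n
  refine fewSmallParts_of_part_kConj_le hc hc1 (h.isPartition hrep.1)
    ((h.subDiag 0).trans hrep.2.1) ((h.subDiag_kConj 0).trans ?_)
  rw [hrep.part_kConj hm hc hc1]
  exact min_le_left _ _

theorem exists_add_cell {m c : ℕ} (hc1 : 1 ≤ c) {l l' : List ℕ} (hl : FewSmallParts m c l)
    (hl' : FewSmallParts m c l') (h : SubDiag l l') (hne : l ≠ l') :
    ∃ p, FewSmallParts m c p ∧ SubDiag l p ∧ SubDiag p l' ∧ p.sum = l.sum + 1 := by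
  induction l' generalizing l c with
  | nil => exact absurd (h.eq_nil hl.1) hne
  | cons y l' ih =>
    obtain ⟨hy, hyl', hp'⟩ := isPartition_cons.1 hl'.1
    have hym : y ≤ m := hl'.2.1
    cases l with
    | nil =>
      refine ⟨[1], ⟨isPartition_cons.2 ⟨one_pos, by simp [part_nil], isPartition_nil⟩,
        hy.trans_le hym, List.countP_le_length.trans hc1⟩,
        subDiag_nil _, subDiag_cons.2 ⟨hy, subDiag_nil _⟩, by simp⟩
    | cons x l =>
      obtain ⟨hx, hxl, hp⟩ := isPartition_cons.1 hl.1
      obtain ⟨hxy, hsub⟩ := subDiag_cons.1 h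
      rcases hxy.lt_or_eq with hxy | rfl
      · refine ⟨(x + 1) :: l, ⟨isPartition_cons.2 ⟨by omega, by omega, hp⟩,
          by rw [part_zero_cons]; omega, ?_⟩, subDiag_cons.2 ⟨by omega, .refl _⟩,
          subDiag_cons.2 ⟨hxy, hsub⟩, by simp only [List.sum_cons]; omega⟩
        have := hl.2.2
        simp only [List.countP_cons, decide_eq_true_eq] at this ⊢
        split_ifs at this ⊢ <;> omega
      · have hne' : l ≠ l' := fun e => hne (by rw [e])
        have hc := hl.2.2
        have hc' := hl'.2.2
        rw [List.countP_cons] at hc hc'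
        have hd : 1 ≤ c - (if x < m then 1 else 0) := by
          split_ifs with hxm
          · have h1 := hl'.length_le hxm
            have : l' ≠ [] := by
              rintro rfl
              exact hne' (hsub.eq_nil hp)
            have := List.length_pos_iff.2 this
            omega
          · exact hc1
        simp only [decide_eq_true_eq] at hc hc'
        obtain ⟨p, ⟨hpp, hpm, hpc⟩, h1, h2, h3⟩ := ih hd ⟨hp, hxl.trans hym, by omega⟩
          ⟨hp', hyl'.trans hym, by omega⟩ hsub hne'
        refine ⟨x :: p, ⟨isPartition_cons.2 ⟨hx, (h2 0).trans hyl', hpp⟩, hym, ?_⟩,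
          subDiag_cons.2 ⟨le_rfl, h1⟩, subDiag_cons.2 ⟨le_rfl, h2⟩,
          by simp only [List.sum_cons]; omega⟩
        simp only [List.countP_cons, decide_eq_true_eq]
        omega

theorem FewSmallParts.kCover {k m c : ℕ} (hm : 1 ≤ m) (hc : m + c = k + 1) (hc1 : 1 ≤ c)
    {l l' : List ℕ} (hl : FewSmallParts m c l) (hl' : FewSmallParts m c l') (h : SubDiag l l')
    (hsum : l'.sum = l.sum + 1) : KCover k l l' := by
  refine ⟨⟨hl.1, hl.2.1.trans (by omega)⟩, ⟨hl'.1, hl'.2.1.trans (by omega)⟩, h, fun j => ?_,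
    hsum⟩
  rw [hl.part_kConj hm hc hc1, hl'.part_kConj hm hc hc1]
  exact min_le_min_left _ (Nat.sub_le_sub_right (h.countP_lt_le hl.1 _) _)

theorem FewSmallParts.kLe {k m c : ℕ} (hm : 1 ≤ m) (hc : m + c = k + 1) (hc1 : 1 ≤ c)
    {l l' : List ℕ} (hl : FewSmallParts m c l) (hl' : FewSmallParts m c l') (h : SubDiag l l') :
    KLe k l l' := by
  induction hd : l'.sum - l.sum generalizing l with
  | zero =>
    by_cases hne : l = l'
    · exact hne ▸ .refl
    · obtain ⟨p, hp, _, h2, h3⟩ := exists_add_cell hc1 hl hl' h hne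
      have := h2.sum_le hp.1
      omega
  | succ d ih =>
    have hne : l ≠ l' := by
      rintro rfl
      omega
    obtain ⟨p, hp, h1, h2, h3⟩ := exists_add_cell hc1 hl hl' h hne
    exact (ih hp h2 (by omega)).head (hl.kCover hm hc hc1 hp h1 h3)

/-- for `λ, μ ∈ L^k(m,n)`, `μ ≼ λ` in the `k`-Young order iff `μ ⊆ λ`;
hence `L^k(m,n)` is isomorphic to the corresponding induced subposet of `L(m,n)`. -/
theorem kLe_iff_subDiag_in_ideal (k m n : ℕ) (hm : 1 ≤ m) (hmk : m ≤ k) (lam μ : List ℕ)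
    (hlam : KLe k lam (List.replicate n m)) (hμ : KLe k μ (List.replicate n m)) :
    KLe k μ lam ↔ SubDiag μ lam := by
  have hc : m + (k - m + 1) = k + 1 := by omega
  have hc1 : 1 ≤ k - m + 1 := by omega
  exact ⟨KLe.subDiag, (hμ.fewSmallParts hm hc hc1).kLe hm hc hc1 (hlam.fewSmallParts hm hc hc1)⟩
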